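/- Every alternating n×n matrix X over a field F is B-congruent to a unique (1,-1)-matrix; that is, there is exactly one (1,-1)-matrix Y such that Y = h'Xh for some h ∈ B. -/

import Mathlib

open Matrix

variable {F : Type*} [Field F] {n : ℕ}

/-- Membership in `B`: invertible upper triangular matrices. -/
def InB (h : Matrix (Fin n) (Fin n) F) : Prop :=
  IsUnit h.det ∧ ∀ i j : Fin n, j < i → h i j = 0

/-- A sub-permutation matrix: at most one nonzero entry in every row and column. -/
def SubPerm (Y : Matrix (Fin n) (Fin n) F) : Prop :=
  (∀ i j k : Fin n, Y i j ≠ 0 → Y i k ≠ 0 → j = k) ∧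
  (∀ i j k : Fin n, Y i k ≠ 0 → Y j k ≠ 0 → i = j)

/-- An alternating matrix: `Xᵀ = -X` and all diagonal entries are 0. -/
def IsAlternating (X : Matrix (Fin n) (Fin n) F) : Prop :=
  Xᵀ = -X ∧ ∀ i, X i i = 0

/-- A (1,-1)-matrix: a sub-permutation alternating matrix whose only nonzero
entries above the main diagonal are equal to 1. -/
def OneNegOne (Y : Matrix (Fin n) (Fin n) F) : Prop :=
  SubPerm Y ∧ IsAlternating Y ∧ ∀ i j : Fin n, i < j → Y i j ≠ 0 → Y i j = 1

theorem InB.mul {g h : Matrix (Fin n) (Fin n) F} (hg : InB g) (hh : InB h) : InB (g * h) := by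
  refine ⟨by rw [det_mul]; exact hg.1.mul hh.1, ?_⟩
  have hg' : BlockTriangular g id := fun i j hij => hg.2 i j hij
  have hh' : BlockTriangular h id := fun i j hij => hh.2 i j hij
  exact fun i j hij => (hg'.mul hh') hij

theorem InB.inv {h : Matrix (Fin n) (Fin n) F} (hh : InB h) : InB h⁻¹ := by
  refine ⟨isUnit_nonsing_inv_det h hh.1, ?_⟩
  have hh' : BlockTriangular h id := fun i j hij => hh.2 i j hij
  have := invertibleOfIsUnitDet h hh.1
  exact fun i j hij => (blockTriangular_inv_of_blockTriangular hh') hij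

theorem InB.diag_ne_zero {h : Matrix (Fin n) (Fin n) F} (hh : InB h) (j : Fin n) :
    h j j ≠ 0 := by
  have hh' : BlockTriangular h id := fun i j hij => hh.2 i j hij
  have hdet := hh.1.ne_zero
  rw [det_of_isUpperTriangular hh', Finset.prod_ne_zero_iff] at hdet
  exact hdet j (Finset.mem_univ j)

theorem inB_of_diag_ne_zero {h : Matrix (Fin n) (Fin n) F}
    (hlow : ∀ i j : Fin n, j < i → h i j = 0) (hdiag : ∀ j, h j j ≠ 0) : InB h := by
  have hh' : BlockTriangular h id := fun i j hij => hlow i j hij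
  refine ⟨?_, hlow⟩
  rw [det_of_isUpperTriangular hh', isUnit_iff_ne_zero, Finset.prod_ne_zero_iff]
  exact fun j _ => hdiag j

theorem inB_one : InB (1 : Matrix (Fin n) (Fin n) F) :=
  ⟨by simp, fun _ _ hij => one_apply_ne hij.ne'⟩

/-- `B`-congruence of matrices. -/
def BCongruent (X Y : Matrix (Fin n) (Fin n) F) : Prop :=
  ∃ h : Matrix (Fin n) (Fin n) F, InB h ∧ Y = hᵀ * X * h

theorem BCongruent.refl (X : Matrix (Fin n) (Fin n) F) : BCongruent X X :=
  ⟨1, inB_one, by simp⟩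

theorem BCongruent.trans {X Y Z : Matrix (Fin n) (Fin n) F} (hXY : BCongruent X Y)
    (hYZ : BCongruent Y Z) : BCongruent X Z := by
  obtain ⟨g, hg, rfl⟩ := hXY
  obtain ⟨h, hh, rfl⟩ := hYZ
  exact ⟨g * h, hg.mul hh, by simp only [transpose_mul, Matrix.mul_assoc]⟩

theorem BCongruent.symm {X Y : Matrix (Fin n) (Fin n) F} (hXY : BCongruent X Y) :
    BCongruent Y X := by
  obtain ⟨h, hh, rfl⟩ := hXY
  refine ⟨h⁻¹, hh.inv, ?_⟩
  have hinv : h * h⁻¹ = 1 := mul_nonsing_inv h hh.1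
  have hinv' : (h⁻¹)ᵀ * hᵀ = 1 := by rw [← transpose_mul, hinv, transpose_one]
  calc X = ((h⁻¹)ᵀ * hᵀ) * X * (h * h⁻¹) := by rw [hinv, hinv', Matrix.one_mul, Matrix.mul_one]
    _ = (h⁻¹)ᵀ * (hᵀ * X * h) * h⁻¹ := by simp only [Matrix.mul_assoc]

theorem IsAlternating.apply_swap {X : Matrix (Fin n) (Fin n) F} (hX : IsAlternating X)
    (i j : Fin n) : X j i = -X i j :=
  congrFun (congrFun hX.1 i) j

theorem IsAlternating.dotProduct_self {X : Matrix (Fin n) (Fin n) F} (hX : IsAlternating X)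
    (v : Fin n → F) : v ⬝ᵥ X *ᵥ v = 0 := by
  simp only [dotProduct, mulVec, Finset.mul_sum]
  rw [← Finset.sum_product']
  refine Finset.sum_involution (fun p _ => (p.2, p.1)) ?_ ?_ (by simp) (by simp)
  · rintro ⟨i, j⟩ -
    simp only [hX.apply_swap i j]
    ring
  · rintro ⟨i, j⟩ - hne heq
    obtain rfl : j = i := congrArg Prod.fst heq
    exact hne (by simp [hX.2 j])

theorem transpose_mul_mul_apply (h X : Matrix (Fin n) (Fin n) F) (k l : Fin n) :
    (hᵀ * X * h) k l = (fun i => h i k) ⬝ᵥ X *ᵥ (fun i => h i l) := by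
  rw [Matrix.mul_assoc]
  rfl

theorem IsAlternating.congr {X Y : Matrix (Fin n) (Fin n) F} (hX : IsAlternating X)
    (hXY : BCongruent X Y) : IsAlternating Y := by
  obtain ⟨h, -, rfl⟩ := hXY
  refine ⟨?_, fun i => ?_⟩
  · simp only [transpose_mul, transpose_transpose, hX.1, Matrix.neg_mul, Matrix.mul_neg,
      Matrix.mul_assoc]
  · rw [transpose_mul_mul_apply, hX.dotProduct_self]

/-- The rows indexed by `S` look like the rows of a (1,-1)-matrix supported on `S`. -/
def ReducedOn (X : Matrix (Fin n) (Fin n) F) (S : Finset (Fin n)) : Prop :=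
  ∀ i ∈ S, ∀ j, X i j ≠ 0 → j ∈ S ∧ (∀ k, X i k ≠ 0 → j = k) ∧ (i < j → X i j = 1)

theorem ReducedOn.oneNegOne {X : Matrix (Fin n) (Fin n) F} (hX : IsAlternating X)
    (hred : ReducedOn X Finset.univ) : OneNegOne X := by
  refine ⟨⟨fun i j k hj hk => (hred i (Finset.mem_univ i) j hj).2.1 k hk,
    fun i j k hi hj => ?_⟩, hX, fun i j hij hne => (hred i (Finset.mem_univ i) j hne).2.2 hij⟩
  refine (hred k (Finset.mem_univ k) i ?_).2.1 j ?_
  · rwa [hX.apply_swap i k, neg_ne_zero]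
  · rwa [hX.apply_swap j k, neg_ne_zero]

/-- The change of basis splitting off the hyperbolic plane spanned by the `i`-th and `j`-th
basis vectors. -/
def splitPlane (X : Matrix (Fin n) (Fin n) F) (i j : Fin n) : Matrix (Fin n) (Fin n) F :=
  fun a k => if k = i then (Pi.single i 1 : Fin n → F) a
    else if k = j then ((X i j)⁻¹ • (Pi.single j 1 : Fin n → F)) a
    else (Pi.single k 1 - ((X i j)⁻¹ * X i k) • Pi.single j 1 +
      ((X i j)⁻¹ * X j k) • Pi.single i 1 : Fin n → F) a

/-- The matrix of the form `X` with respect to the basis `splitPlane X i j`. -/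
theorem splitPlane_spec {X : Matrix (Fin n) (Fin n) F} (hX : IsAlternating X) {i j : Fin n}
    (hij : X i j ≠ 0) :
    ((splitPlane X i j)ᵀ * X * splitPlane X i j) i j = 1 ∧
    (∀ k, k ≠ j → ((splitPlane X i j)ᵀ * X * splitPlane X i j) i k = 0) ∧
    (∀ k, k ≠ i → ((splitPlane X i j)ᵀ * X * splitPlane X i j) j k = 0) ∧
    (∀ k, X i k = 0 → X j k = 0 → ∀ l,
      ((splitPlane X i j)ᵀ * X * splitPlane X i j) k l = X k l) := by
  have hne : i ≠ j := by rintro rfl; exact hij (hX.2 i)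
  have hcol : ∀ k, (fun a => splitPlane X i j a k) = if k = i then (Pi.single i 1 : Fin n → F)
      else if k = j then (X i j)⁻¹ • (Pi.single j 1 : Fin n → F)
      else (Pi.single k 1 - ((X i j)⁻¹ * X i k) • Pi.single j 1 +
        ((X i j)⁻¹ * X j k) • Pi.single i 1 : Fin n → F) := by
    intro k
    funext a
    simp only [splitPlane]
    split_ifs <;> rfl
  have hji := hX.apply_swap i j
  have hii := hX.2 i
  have hjj := hX.2 j
  simp only [transpose_mul_mul_apply, hcol]
  refine ⟨?_, fun k hk => ?_, fun k hk => ?_, fun k hik hjk l => ?_⟩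
  · simp [hne.symm, hij, mulVec_smul]
  · by_cases hki : k = i
    · simp [hki, hii]
    · simp [hk, hki, mulVec_add, mulVec_sub, mulVec_smul, hii]
      field_simp
      ring
  · by_cases hkj : k = j
    · simp [hkj, hne.symm, mulVec_smul, hjj]
    · simp [hk, hkj, hne.symm, mulVec_add, mulVec_sub, mulVec_smul, hjj, hji]
      field_simp
      simp
  · have hki : k ≠ i := by rintro rfl; simp_all
    have hkj : k ≠ j := by rintro rfl; simp_all
    have hik' : X k i = 0 := by rw [hX.apply_swap i k, hik, neg_zero]
    have hjk' : X k j = 0 := by rw [hX.apply_swap j k, hjk, neg_zero]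
    by_cases hli : l = i
    · simp [hki, hkj, hli, hik, hjk]
    · by_cases hlj : l = j
      · simp [hki, hkj, hlj, hne.symm, hik, hjk, hjk', mulVec_smul]
      · simp [hki, hkj, hli, hlj, hik, hjk, hik', hjk', mulVec_add, mulVec_sub, mulVec_smul]

theorem inB_splitPlane {X : Matrix (Fin n) (Fin n) F} {i j : Fin n} (hij : X i j ≠ 0)
    (hlt : i < j) (hi : ∀ k, k < i → X j k = 0) (hj : ∀ k, k < j → X i k = 0) :
    InB (splitPlane X i j) := by
  refine inB_of_diag_ne_zero (fun a k hka => ?_) (fun k => ?_)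
  · by_cases hki : k = i
    · subst hki
      simp [splitPlane, hka.ne']
    · by_cases hkj : k = j
      · subst hkj
        simp [splitPlane, hlt.ne', hka.ne']
      · have h1 : X i k * (Pi.single j 1 : Fin n → F) a = 0 := by
          by_cases haj : a = j
          · rw [hj k (haj ▸ hka), zero_mul]
          · simp [haj]
        have h2 : X j k * (Pi.single i 1 : Fin n → F) a = 0 := by
          by_cases hai : a = i
          · rw [hi k (hai ▸ hka), zero_mul]
          · simp [hai]
        simp [splitPlane, hki, hkj, hka.ne', mul_assoc, h1, h2]
  · by_cases hki : k = i
    · simp [splitPlane, hki]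
    · by_cases hkj : k = j
      · simp [splitPlane, hkj, hlt.ne', hij]
      · simp [splitPlane, hki, hkj]

theorem ReducedOn.exists_larger {X : Matrix (Fin n) (Fin n) F} (hX : IsAlternating X)
    {S : Finset (Fin n)} (hred : ReducedOn X S) (hS : Sᶜ.Nonempty) :
    ∃ Y T, BCongruent X Y ∧ ReducedOn Y T ∧ S ⊂ T := by
  obtain ⟨i, hiS, hmin⟩ := Finset.exists_min_image Sᶜ id hS
  rw [Finset.mem_compl] at hiS
  have hlow : ∀ k, k < i → k ∈ S := fun k hk => by
    by_contra hkS
    exact (hmin k (Finset.mem_compl.2 hkS)).not_gt hk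
  have hzero : ∀ a, a ∉ S → ∀ k ∈ S, X a k = 0 := fun a ha k hk => by
    by_contra hne
    refine ha (hred k hk a ?_).1
    rwa [hX.apply_swap a k, neg_ne_zero]
  by_cases hrow : ∀ j, X i j = 0
  · refine ⟨X, insert i S, BCongruent.refl X, fun a ha b hab => ?_, Finset.ssubset_insert hiS⟩
    rcases Finset.mem_insert.1 ha with rfl | ha
    · exact absurd (hrow b) hab
    · exact ⟨Finset.mem_insert_of_mem (hred a ha b hab).1, (hred a ha b hab).2⟩
  · classical
    push Not at hrow
    obtain ⟨j, hj, hjmin⟩ := Finset.exists_min_image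
      (Finset.univ.filter fun j => X i j ≠ 0) id (by simpa [Finset.Nonempty] using hrow)
    have hij : X i j ≠ 0 := (Finset.mem_filter.1 hj).2
    have hjS : j ∉ S := fun h => hij (hzero i hiS j h)
    have hne : i ≠ j := by rintro rfl; exact hij (hX.2 i)
    have hlt : i < j := lt_of_le_of_ne (not_lt.1 fun h => hjS (hlow j h)) hne
    have hcong : BCongruent X ((splitPlane X i j)ᵀ * X * splitPlane X i j) := by
      refine ⟨_, inB_splitPlane hij hlt (fun k hk => hzero j hjS k (hlow k hk))
        (fun k hk => ?_), rfl⟩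
      by_contra hik
      exact (hjmin k (by simpa using hik)).not_gt hk
    obtain ⟨h1, h2, h3, h4⟩ := splitPlane_spec hX hij
    refine ⟨_, insert i (insert j S), hcong, fun a ha b hab => ?_, ?_⟩
    · rcases Finset.mem_insert.1 ha with rfl | ha
      · obtain rfl : b = j := by_contra fun hb => hab (h2 b hb)
        exact ⟨by simp, fun k hk => by_contra fun hb => hk (h2 k (Ne.symm hb)), fun _ => h1⟩
      rcases Finset.mem_insert.1 ha with rfl | ha
      · obtain rfl : b = i := by_contra fun hb => hab (h3 b hb)
        exact ⟨by simp, fun k hk => by_contra fun hb => hk (h3 k (Ne.symm hb)),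
          fun h => absurd h hlt.not_gt⟩
      · have hrow_a := h4 a (hzero i hiS a ha) (hzero j hjS a ha)
        simp only [hrow_a] at hab ⊢
        obtain ⟨hb, hr⟩ := hred a ha b hab
        exact ⟨by simp [hb], hr⟩
    · refine Finset.ssubset_iff.2 ⟨i, hiS, Finset.insert_subset_insert i ?_⟩
      exact Finset.subset_insert j S

theorem ReducedOn.exists_oneNegOne {X : Matrix (Fin n) (Fin n) F} (hX : IsAlternating X)
    {S : Finset (Fin n)} (hred : ReducedOn X S) : ∃ Y, OneNegOne Y ∧ BCongruent X Y := by
  induction S using WellFoundedGT.induction generalizing X with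
  | ind S ih =>
    rcases Sᶜ.eq_empty_or_nonempty with hS | hS
    · rw [Finset.compl_eq_empty_iff] at hS
      exact ⟨X, (hS ▸ hred).oneNegOne hX, BCongruent.refl X⟩
    · obtain ⟨Y, T, hXY, hY, hST⟩ := hred.exists_larger hX hS
      obtain ⟨Z, hZ, hYZ⟩ := ih T hST (hX.congr hXY) hY
      exact ⟨Z, hZ, hXY.trans hYZ⟩

theorem SubPerm.exists_le_ne_zero {Y Z : Matrix (Fin n) (Fin n) F} (hY : SubPerm Y)
    (hYZ : BCongruent Y Z) {i j : Fin n} (hij : Y i j ≠ 0) : ∃ k ≤ i, Z k j ≠ 0 := by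
  obtain ⟨h, hh, rfl⟩ := hYZ
  have hinv : (h⁻¹)ᵀ * hᵀ = 1 := by
    rw [← transpose_mul, mul_nonsing_inv h hh.1, transpose_one]
  have hYh : Y * h = (h⁻¹)ᵀ * (hᵀ * Y * h) := by
    rw [Matrix.mul_assoc, ← Matrix.mul_assoc, hinv, Matrix.one_mul]
  have hne : (Y * h) i j ≠ 0 := by
    rw [mul_apply, Finset.sum_eq_single j]
    · exact mul_ne_zero hij (hh.diag_ne_zero j)
    · intro k _ hk
      rw [by_contra fun hik => hk (hY.1 i k j hik hij), zero_mul]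
    · simp
  rw [hYh, mul_apply] at hne
  obtain ⟨k, -, hk⟩ := Finset.exists_ne_zero_of_sum_ne_zero hne
  refine ⟨k, not_lt.1 fun hik => left_ne_zero_of_mul hk ?_, right_ne_zero_of_mul hk⟩
  exact hh.inv.2 k i hik

theorem SubPerm.ne_zero_of_bCongruent {Y Z : Matrix (Fin n) (Fin n) F} (hY : SubPerm Y)
    (hZ : SubPerm Z) (hYZ : BCongruent Y Z) {i j : Fin n} (hij : Y i j ≠ 0) : Z i j ≠ 0 := by
  obtain ⟨k, hki, hk⟩ := hY.exists_le_ne_zero hYZ hij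
  obtain ⟨l, hlk, hl⟩ := hZ.exists_le_ne_zero hYZ.symm hk
  obtain rfl : l = i := hY.2 l i j hl hij
  rwa [le_antisymm hlk hki]

theorem OneNegOne.apply_eq_of_ne_zero {Y : Matrix (Fin n) (Fin n) F} (hY : OneNegOne Y)
    {i j : Fin n} (hij : Y i j ≠ 0) : Y i j = if i < j then 1 else -1 := by
  split_ifs with hlt
  · exact hY.2.2 i j hlt hij
  · have hne : j ≠ i := by rintro rfl; exact hij (hY.2.1.2 j)
    have hswap := hY.2.1.apply_swap j i
    rw [hswap, hY.2.2 j i (lt_of_le_of_ne (not_lt.1 hlt) hne)]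
    rwa [hswap, neg_ne_zero] at hij

theorem OneNegOne.eq_of_bCongruent {Y Z : Matrix (Fin n) (Fin n) F} (hY : OneNegOne Y)
    (hZ : OneNegOne Z) (hYZ : BCongruent Y Z) : Y = Z := by
  ext i j
  by_cases hij : Y i j = 0
  · by_contra hne
    exact hZ.1.ne_zero_of_bCongruent hY.1 hYZ.symm (fun h => hne (hij.trans h.symm)) hij
  · rw [hY.apply_eq_of_ne_zero hij,
      hZ.apply_eq_of_ne_zero (hY.1.ne_zero_of_bCongruent hZ.1 hYZ hij)]

/-- Every alternating matrix is `B`-congruent to a unique (1,-1)-matrix. -/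
theorem alt_unique_oneNegOne_B_congruent (hn : 2 ≤ n)
    (X : Matrix (Fin n) (Fin n) F) (hX : IsAlternating X) :
    ∃! Y : Matrix (Fin n) (Fin n) F, OneNegOne Y ∧
      ∃ h : Matrix (Fin n) (Fin n) F, InB h ∧ Y = hᵀ * X * h := by
  have hred : ReducedOn X ∅ := fun i hi => absurd hi (Finset.notMem_empty i)
  obtain ⟨Y, hY, hXY⟩ := hred.exists_oneNegOne hX
  refine ⟨Y, ⟨hY, hXY⟩, fun Z hZ => ?_⟩
  exact hZ.1.eq_of_bCongruent hY (BCongruent.trans (BCongruent.symm hZ.2) hXY)
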